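/- Let X be a Banach two-sided ℍ-module, let D(A) be a right ℍ-submodule of X, and let A : D(A) → X be a closed right linear operator. Then for every N ∈ ℕ and all q0, q ∈ ρ_S(A): S_q⁻¹(A) = Σ_{k=0}^{N} Q_{q0}(A)^k S_{q0}⁻¹(A) Δ_{q0}(q)^k − Σ_{k=0}^{N} Q_{q0}(A)^{k+1} (q − q0) Δ_{q0}(q)^k + Q_{q0}(A)^{N+1} S_q⁻¹(A) Δ_{q0}(q)^{N+1}. -/

import Mathlib

open MulOpposite Filter Topology Classical

noncomputable section

notation "ℍ" => Quaternion ℝ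

/-- A *Banach two-sided `ℍ`-module*: a two-sided `ℍ`-module (left `ℍ`-action, right
`ℍ`-action encoded as a left `ℍᵐᵒᵖ`-action) whose complete norm satisfies
`‖qx‖ = ‖xq‖ = |q|‖x‖`, and where real scalars act the same on both sides. -/
class QuatBimodule (Y : Type*) [NormedAddCommGroup Y]
    [Module ℍ Y] [Module ℍᵐᵒᵖ Y] : Prop where
  smul_op_comm : ∀ (p q : ℍ) (y : Y), p • (op q • y) = op q • (p • y)
  norm_smul_left : ∀ (q : ℍ) (y : Y), ‖q • y‖ = ‖q‖ * ‖y‖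
  norm_smul_right : ∀ (q : ℍ) (y : Y), ‖op q • y‖ = ‖q‖ * ‖y‖
  real_smul_comm : ∀ (r : ℝ) (y : Y), ((r : ℝ) : ℍ) • y = op ((r : ℝ) : ℍ) • y

variable {X : Type*} [NormedAddCommGroup X] [Module ℍ X] [Module ℍᵐᵒᵖ X]

/-- Membership in `Lin^r(X)`: additive, right `ℍ`-linear, with finite operator
norm (i.e. `‖B x‖` is bounded on the closed unit ball). -/
def MemLinR (B : X → X) : Prop :=
  (∀ x y : X, B (x + y) = B x + B y) ∧
  (∀ (q : ℍ) (x : X), B (op q • x) = op q • B x) ∧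
  BddAbove ((fun x : X => ‖B x‖) '' {x : X | ‖x‖ ≤ 1})

/-- The operator norm `‖B‖ = sup {‖B x‖ : ‖x‖ ≤ 1}`. -/
def opNorm (B : X → X) : ℝ :=
  sSup ((fun x : X => ‖B x‖) '' {x : X | ‖x‖ ≤ 1})

/-- A right linear operator `A : D(A) → X`, where `D(A)` is a right `ℍ`-submodule
of `X`.  It is encoded as a function `X → X` together with its domain; only the
values on the domain are relevant. -/
structure RightLinearOp (X : Type*) [NormedAddCommGroup X]
    [Module ℍ X] [Module ℍᵐᵒᵖ X] where
  dom : Set X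
  toFun : X → X
  zero_mem : (0 : X) ∈ dom
  add_mem : ∀ ⦃x⦄, x ∈ dom → ∀ ⦃y⦄, y ∈ dom → x + y ∈ dom
  neg_mem : ∀ ⦃x⦄, x ∈ dom → -x ∈ dom
  smulR_mem : ∀ (q : ℍ) ⦃x⦄, x ∈ dom → op q • x ∈ dom
  map_add' : ∀ ⦃x⦄, x ∈ dom → ∀ ⦃y⦄, y ∈ dom → toFun (x + y) = toFun x + toFun y
  map_smulR' : ∀ (q : ℍ) ⦃x⦄, x ∈ dom → toFun (op q • x) = op q • toFun x

namespace RightLinearOp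

variable (T : RightLinearOp X)

/-- `A` is closed: its graph is closed in `X × X`. -/
def IsClosedOp : Prop := IsClosed {p : X × X | p.1 ∈ T.dom ∧ T.toFun p.1 = p.2}

/-- The domain `D(A²)` of `A²`. -/
def dom2 : Set X := {x | x ∈ T.dom ∧ T.toFun x ∈ T.dom}

/-- The operator `Δ_q(A) = A² − 2 Re(q) A + |q|² Id`, with domain `D(A²)`. -/
def delta (q : ℍ) (x : X) : X :=
  T.toFun (T.toFun x) - ((2 * q.re : ℝ) : ℍ) • T.toFun x + ((‖q‖ ^ 2 : ℝ) : ℍ) • x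

/-- `B` is the inverse of `Δ_q(A) : D(A²) → X`, and `B ∈ Lin^r(X)`. -/
def IsQInv (q : ℍ) (B : X → X) : Prop :=
  MemLinR B ∧ (∀ x : X, B x ∈ T.dom2) ∧ (∀ x : X, T.delta q (B x) = x) ∧
    ∀ x ∈ T.dom2, B (T.delta q x) = x

/-- The S-resolvent set `ρ_S(A)`. -/
def rhoS : Set ℍ := {q | ∃ B : X → X, T.IsQInv q B}

/-- `Q_q(A) = Δ_q(A)⁻¹ ∈ Lin^r(X)`, for `q ∈ ρ_S(A)` (junk value otherwise). -/
def qres (q : ℍ) : X → X :=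
  if h : q ∈ T.rhoS then h.choose else fun _ => 0

/-- The (left) S-resolvent operator `S_q⁻¹(A) = Q_q(A) q̄ − A Q_q(A)`, where the
right scalar multiple of an operator is `(B q̄)(x) = B(q̄ x)`. -/
def sres (q : ℍ) : X → X :=
  fun x => T.qres q (star q • x) - T.toFun (T.qres q x)

/-- The coefficients `B_n`: `B_{2k} = Q_{q0}(A)^k`, `B_{2k+1} = Q_{q0}(A)^k S_{q0}⁻¹(A)`. -/
def Bop (q0 : ℍ) (n : ℕ) : X → X :=
  if n % 2 = 0 then (T.qres q0)^[n / 2] else (T.qres q0)^[n / 2] ∘ T.sres q0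

end RightLinearOp

/-- The quaternionic polynomial `Δ_q(p) = p² − 2 Re(q) p + |q|²`. -/
def deltaPoly (q p : ℍ) : ℍ :=
  p ^ 2 - ((2 * q.re : ℝ) : ℍ) * p + ((‖q‖ ^ 2 : ℝ) : ℍ)

/-- The "powers" `p_{q0,n}`: `p_{q0,2k}(q) = Δ_{q0}(q)^k`,
`p_{q0,2k+1}(q) = (q − q0) Δ_{q0}(q)^k`. -/
def spow (q0 : ℍ) (n : ℕ) (q : ℍ) : ℍ :=
  if n % 2 = 0 then deltaPoly q0 q ^ (n / 2) else (q - q0) * deltaPoly q0 q ^ (n / 2)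

/-- The Cassini pseudo-metric `u(p,q) = √|Δ_q(p)|`. -/
def cassini (p q : ℍ) : ℝ := Real.sqrt ‖deltaPoly q p‖

/-- The Cassini ball `U(q0,R)`. -/
def cassiniBall (q0 : ℍ) (R : ℝ) : Set ℍ := {p : ℍ | cassini p q0 < R}

/-- The Cassini topology on `ℍ`: the topology induced by the Cassini pseudo-metric,
i.e. the topology generated by the Cassini balls. -/
def cassiniTopology : TopologicalSpace ℍ :=
  TopologicalSpace.generateFrom {U : Set ℍ | ∃ q0 R, 0 < R ∧ U = cassiniBall q0 R}

/-- The spherical derivative of a function `g : ℍ → ℍ`. -/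
def sderivQ (g : ℍ → ℍ) (q : ℍ) : ℍ :=
  if q.im = 0 then deriv (fun t : ℝ => g ((t : ℝ) : ℍ)) q.re
  else (g q - g (star q)) * (q - star q)⁻¹

end

theorem self_add_star_eq_coe_two_mul_re (q : ℍ) : q + star q = ((2 * q.re : ℝ) : ℍ) := by
  rw [Quaternion.self_add_star, Quaternion.coe_mul]
  rfl

theorem star_mul_self_eq_coe_norm_sq (q : ℍ) : star q * q = ((‖q‖ ^ 2 : ℝ) : ℍ) := by
  rw [Quaternion.star_mul_self, Quaternion.normSq_eq_norm_mul_self, pow_two]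

theorem deltaPoly_self (q : ℍ) : deltaPoly q q = 0 := by
  rw [deltaPoly, ← self_add_star_eq_coe_two_mul_re, ← star_mul_self_eq_coe_norm_sq]
  noncomm_ring

namespace RightLinearOp

section Expansion

variable {X : Type*} [NormedAddCommGroup X] [Module ℍ X] [Module ℍᵐᵒᵖ X]

theorem isQInv_qres (T : RightLinearOp X) {q : ℍ} (hq : q ∈ T.rhoS) :
    T.IsQInv q (T.qres q) := by
  have h : T.qres q = hq.choose := dif_pos hq
  rw [h]
  exact hq.choose_spec

theorem map_sub (T : RightLinearOp X) {x y : X} (hx : x ∈ T.dom) (hy : y ∈ T.dom) :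
    T.toFun (x - y) = T.toFun x - T.toFun y := by
  have h := T.map_add' (T.add_mem hx (T.neg_mem hy)) hy
  rw [neg_add_cancel_right] at h
  rw [sub_eq_add_neg x y, h, add_sub_cancel_right]

theorem sub_mem (T : RightLinearOp X) {x y : X} (hx : x ∈ T.dom) (hy : y ∈ T.dom) :
    x - y ∈ T.dom := by
  rw [sub_eq_add_neg]
  exact T.add_mem hx (T.neg_mem hy)

theorem map_real_smul [QuatBimodule X] (T : RightLinearOp X) (r : ℝ) {x : X} (hx : x ∈ T.dom) :
    T.toFun ((r : ℍ) • x) = (r : ℍ) • T.toFun x := by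
  rw [QuatBimodule.real_smul_comm, T.map_smulR' _ hx, QuatBimodule.real_smul_comm]

section Resolvent

variable (T : RightLinearOp X) {q : ℍ}

theorem qres_add (hq : q ∈ T.rhoS) (x y : X) :
    T.qres q (x + y) = T.qres q x + T.qres q y :=
  (T.isQInv_qres hq).1.1 x y

theorem qres_sub (hq : q ∈ T.rhoS) (x y : X) :
    T.qres q (x - y) = T.qres q x - T.qres q y :=
  _root_.map_sub (AddMonoidHom.mk' (T.qres q) (T.qres_add hq)) x y

theorem iterate_qres_add (hq : q ∈ T.rhoS) (n : ℕ) (x y : X) :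
    (T.qres q)^[n] (x + y) = (T.qres q)^[n] x + (T.qres q)^[n] y :=
  iterate_map_add (AddMonoidHom.mk' (T.qres q) (T.qres_add hq)) n x y

theorem iterate_qres_sub (hq : q ∈ T.rhoS) (n : ℕ) (x y : X) :
    (T.qres q)^[n] (x - y) = (T.qres q)^[n] x - (T.qres q)^[n] y :=
  iterate_map_sub (AddMonoidHom.mk' (T.qres q) (T.qres_add hq)) n x y

theorem qres_mem_dom (hq : q ∈ T.rhoS) (x : X) : T.qres q x ∈ T.dom :=
  ((T.isQInv_qres hq).2.1 x).1

theorem map_qres_mem_dom (hq : q ∈ T.rhoS) (x : X) : T.toFun (T.qres q x) ∈ T.dom :=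
  ((T.isQInv_qres hq).2.1 x).2

theorem sres_mem_dom (hq : q ∈ T.rhoS) (x : X) : T.sres q x ∈ T.dom :=
  T.sub_mem (T.qres_mem_dom hq _) (T.map_qres_mem_dom hq _)

theorem sres_add (hq : q ∈ T.rhoS) (x y : X) :
    T.sres q (x + y) = T.sres q x + T.sres q y := by
  simp only [sres]
  rw [smul_add, T.qres_add hq, T.qres_add hq,
    T.map_add' (T.qres_mem_dom hq _) (T.qres_mem_dom hq _)]
  abel

theorem sres_sub (hq : q ∈ T.rhoS) (x y : X) :
    T.sres q (x - y) = T.sres q x - T.sres q y :=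
  _root_.map_sub (AddMonoidHom.mk' (T.sres q) (T.sres_add hq)) x y

variable [QuatBimodule X]

theorem qres_real_smul (hq : q ∈ T.rhoS) (r : ℝ) (x : X) :
    T.qres q ((r : ℍ) • x) = (r : ℍ) • T.qres q x := by
  rw [QuatBimodule.real_smul_comm, (T.isQInv_qres hq).1.2.1, QuatBimodule.real_smul_comm]

theorem sres_real_smul (hq : q ∈ T.rhoS) (r : ℝ) (x : X) :
    T.sres q ((r : ℍ) • x) = (r : ℍ) • T.sres q x := by
  simp only [sres]
  rw [smul_smul, ← Quaternion.coe_commutes, ← smul_smul, T.qres_real_smul hq,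
    T.qres_real_smul hq, T.map_real_smul r (T.qres_mem_dom hq _), smul_sub]

/-- The S-resolvent equation `A S_q⁻¹(A) = S_q⁻¹(A) q - Id`. -/
theorem map_sres (hq : q ∈ T.rhoS) (x : X) :
    T.toFun (T.sres q x) = T.sres q (q • x) - x := by
  have hmul : star q • q • x = ((‖q‖ ^ 2 : ℝ) : ℍ) • x := by
    rw [smul_smul, star_mul_self_eq_coe_norm_sq]
  have hadd : q • x + star q • x = ((2 * q.re : ℝ) : ℍ) • x := by
    rw [← add_smul, self_add_star_eq_coe_two_mul_re]
  have hA : T.toFun (T.qres q (q • x)) + T.toFun (T.qres q (star q • x)) =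
      ((2 * q.re : ℝ) : ℍ) • T.toFun (T.qres q x) := by
    rw [← T.map_add' (T.qres_mem_dom hq _) (T.qres_mem_dom hq _), ← T.qres_add hq, hadd,
      T.qres_real_smul hq, T.map_real_smul _ (T.qres_mem_dom hq _)]
  have hΔ := (T.isQInv_qres hq).2.2.1 x
  simp only [delta, ← hA] at hΔ
  simp only [sres]
  rw [T.map_sub (T.qres_mem_dom hq _) (T.map_qres_mem_dom hq _), hmul, T.qres_real_smul hq,
    eq_sub_iff_add_eq]
  conv_lhs => arg 2; rw [← hΔ]
  abel

theorem sres_deltaPoly_smul (hq : q ∈ T.rhoS) (p : ℍ) (x : X) :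
    T.sres q (deltaPoly p q • x) = T.sres q (q • q • x)
      - ((2 * p.re : ℝ) : ℍ) • T.sres q (q • x) + ((‖p‖ ^ 2 : ℝ) : ℍ) • T.sres q x := by
  rw [deltaPoly, add_smul, sub_smul, pow_two, mul_smul, mul_smul, T.sres_add hq, T.sres_sub hq,
    T.sres_real_smul hq, T.sres_real_smul hq]

end Resolvent

variable [QuatBimodule X]

theorem sres_eq_sres_sub_add (T : RightLinearOp X) {q₀ q : ℍ} (hq₀ : q₀ ∈ T.rhoS)
    (hq : q ∈ T.rhoS) (x : X) :
    T.sres q x = T.sres q₀ x - T.qres q₀ ((q - q₀) • x) +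
      T.qres q₀ (T.sres q (deltaPoly q₀ q • x)) := by
  have hmap : T.toFun (T.sres q x - T.sres q₀ x) = T.sres q (q • x) - T.sres q₀ (q₀ • x) := by
    rw [T.map_sub (T.sres_mem_dom hq _) (T.sres_mem_dom hq₀ _), T.map_sres hq, T.map_sres hq₀]
    abel
  have hmem : T.sres q x - T.sres q₀ x ∈ T.dom2 := by
    refine ⟨T.sub_mem (T.sres_mem_dom hq _) (T.sres_mem_dom hq₀ _), ?_⟩
    rw [hmap]
    exact T.sub_mem (T.sres_mem_dom hq _) (T.sres_mem_dom hq₀ _)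
  have hzero := T.sres_deltaPoly_smul hq₀ q₀ x
  have hsub := T.sres_sub hq₀ x x
  rw [sub_self, sub_self] at hsub
  rw [deltaPoly_self, zero_smul, hsub] at hzero
  have hΔ : T.delta q₀ (T.sres q x - T.sres q₀ x) =
      T.sres q (deltaPoly q₀ q • x) - (q - q₀) • x := by
    rw [delta, hmap, T.map_sub (T.sres_mem_dom hq _) (T.sres_mem_dom hq₀ _), T.map_sres hq,
      T.map_sres hq₀, ← sub_zero (T.sres q (deltaPoly q₀ q • x)), hzero,
      T.sres_deltaPoly_smul hq, smul_sub, smul_sub, sub_smul]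
    abel
  have h := (T.isQInv_qres hq₀).2.2.2 _ hmem
  rw [hΔ, T.qres_sub hq₀] at h
  rw [← sub_add_cancel (T.sres q x) (T.sres q₀ x), ← h]
  abel

end Expansion

end RightLinearOp

/-- Proposition `P:sviluppoN`: for every `N ∈ ℕ` and all
`q0, q ∈ ρ_S(A)`,
`S_q⁻¹(A) = Σ_{k=0}^{N} Q_{q0}(A)^k S_{q0}⁻¹(A) Δ_{q0}(q)^k
  − Σ_{k=0}^{N} Q_{q0}(A)^{k+1} (q − q0) Δ_{q0}(q)^k
  + Q_{q0}(A)^{N+1} S_q⁻¹(A) Δ_{q0}(q)^{N+1}`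
(equality of operators; right quaternionic scalars act by `(B c)(x) = B(c x)`). -/
theorem stmt17 {X : Type*} [NormedAddCommGroup X] [CompleteSpace X]
    [Module ℍ X] [Module ℍᵐᵒᵖ X] [QuatBimodule X]
    (T : RightLinearOp X) (hT : T.IsClosedOp) :
    ∀ N : ℕ, ∀ q0 ∈ T.rhoS, ∀ q ∈ T.rhoS, ∀ x : X,
      T.sres q x =
        (∑ k ∈ Finset.range (N + 1),
          (T.qres q0)^[k] (T.sres q0 ((deltaPoly q0 q ^ k) • x))) -
        (∑ k ∈ Finset.range (N + 1),
          (T.qres q0)^[k + 1] (((q - q0) * deltaPoly q0 q ^ k) • x)) +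
        (T.qres q0)^[N + 1] (T.sres q ((deltaPoly q0 q ^ (N + 1)) • x)) := by
  intro N q0 hq0 q hq x
  induction N with
  | zero => simpa using T.sres_eq_sres_sub_add hq0 hq x
  | succ N ih =>
    rw [ih, T.sres_eq_sres_sub_add hq0 hq (deltaPoly q0 q ^ (N + 1) • x), smul_smul, smul_smul,
      ← pow_succ', T.iterate_qres_add hq0, T.iterate_qres_sub hq0, ← Function.iterate_succ_apply,
      ← Function.iterate_succ_apply, Finset.sum_range_succ _ (N + 1),
      Finset.sum_range_succ _ (N + 1)]
    abel
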